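/- Let C be a finitely complete, Barr-exact and amalgamable category. Then every Mal'cev span (f : C → A, g : C → B) in which g is a regular epimorphism admits a pushout which is stable under pullback and is itself a pullback square. -/

import Mathlib

open CategoryTheory CategoryTheory.Limits

universe v u

section Defs

variable {C : Type u} [Category.{v} C]

/-- A span `(f, g)` is *jointly monic* if `u ≫ f = v ≫ f` and `u ≫ g = v ≫ g` imply `u = v`
(equivalently, the induced map into the product is a monomorphism). -/
def JointlyMonic {Z A B : C} (f : Z ⟶ A) (g : Z ⟶ B) : Prop :=
  ∀ ⦃X : C⦄ (u v : X ⟶ Z), u ≫ f = v ≫ f → u ≫ g = v ≫ g → u = v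

/-- `(P, π₁, π₂, π₃)` is the limit `C ×_B C ×_A C` of triples `(c₁, c₂, c₃)` of generalized
elements of `Z` with `g ∘ π₁ = g ∘ π₂` and `f ∘ π₂ = f ∘ π₃`. -/
structure IsTripleLimit {Z A B : C} (f : Z ⟶ A) (g : Z ⟶ B) {P : C}
    (π₁ π₂ π₃ : P ⟶ Z) : Prop where
  w₁ : π₁ ≫ g = π₂ ≫ g
  w₂ : π₂ ≫ f = π₃ ≫ f
  lift : ∀ ⦃X : C⦄ (x₁ x₂ x₃ : X ⟶ Z), x₁ ≫ g = x₂ ≫ g → x₂ ≫ f = x₃ ≫ f →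
    ∃! u : X ⟶ P, u ≫ π₁ = x₁ ∧ u ≫ π₂ = x₂ ∧ u ≫ π₃ = x₃

/-- A jointly monic span `(f, g)` is a *Mal'cev span* if, for the limit
`P = C ×_B C ×_A C`, there exists `p : P ⟶ C` with `f ∘ p = f ∘ π₁` and `g ∘ p = g ∘ π₃`. -/
def IsMalcevSpan {Z A B : C} (f : Z ⟶ A) (g : Z ⟶ B) : Prop :=
  JointlyMonic f g ∧
  ∀ ⦃P : C⦄ (π₁ π₂ π₃ : P ⟶ Z), IsTripleLimit f g π₁ π₂ π₃ →
    ∃ p : P ⟶ Z, p ≫ f = π₁ ≫ f ∧ p ≫ g = π₃ ≫ g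

/-- A commuting square (with legs `f, g` and colegs `h, k`) is *stable under pullback* if
every commutative cube over it whose four side faces are pullbacks has a pushout top face. -/
def PushoutStable {Z A B D : C} (f : Z ⟶ A) (g : Z ⟶ B) (h : A ⟶ D) (k : B ⟶ D) : Prop :=
  ∀ ⦃Z' A' B' D' : C⦄ (f' : Z' ⟶ A') (g' : Z' ⟶ B') (h' : A' ⟶ D') (k' : B' ⟶ D')
    (αZ : Z' ⟶ Z) (αA : A' ⟶ A) (αB : B' ⟶ B) (αD : D' ⟶ D),
    IsPullback f' αZ αA f → IsPullback g' αZ αB g →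
    IsPullback h' αA αD h → IsPullback k' αB αD k →
    f' ≫ h' = g' ≫ k' → IsPushout f' g' h' k'

/-- A category is *diexact* if every Mal'cev span admits a pushout, and every pushout square
of a Mal'cev span is stable under pullback and is itself a pullback square. -/
def Diexact (C : Type u) [Category.{v} C] : Prop :=
  ∀ ⦃Z A B : C⦄ (f : Z ⟶ A) (g : Z ⟶ B), IsMalcevSpan f g →
    (∃ (D : C) (h : A ⟶ D) (k : B ⟶ D), IsPushout f g h k) ∧
    ∀ ⦃D : C⦄ (h : A ⟶ D) (k : B ⟶ D), IsPushout f g h k →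
      PushoutStable f g h k ∧ IsPullback f g h k

/-- An internal equivalence relation: a jointly monic pair which is reflexive, symmetric
and transitive. -/
def IsEquivRelation [HasPullbacks C] {E A : C} (s t : E ⟶ A) : Prop :=
  JointlyMonic s t ∧
  (∃ r : A ⟶ E, r ≫ s = 𝟙 A ∧ r ≫ t = 𝟙 A) ∧
  (∃ σ : E ⟶ E, σ ≫ s = t ∧ σ ≫ t = s) ∧
  (∃ τ : pullback t s ⟶ E,
     τ ≫ s = pullback.fst t s ≫ s ∧ τ ≫ t = pullback.snd t s ≫ t)

/-- A finitely complete category is *Barr-exact* if every kernel pair has a coequaliser,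
regular epimorphisms are stable under pullback, and every internal equivalence relation is
effective (i.e. a kernel pair). -/
def BarrExact (C : Type u) [Category.{v} C] [HasFiniteLimits C] : Prop :=
  (∀ ⦃X Y : C⦄ (f : X ⟶ Y), HasCoequalizer (pullback.fst f f) (pullback.snd f f)) ∧
  (∀ ⦃X Y W : C⦄ (f : X ⟶ Y) (g : W ⟶ Y),
     Nonempty (RegularEpi f) → Nonempty (RegularEpi (pullback.snd f g))) ∧
  (∀ ⦃E A : C⦄ (s t : E ⟶ A), IsEquivRelation s t →
     ∃ (Q : C) (q : A ⟶ Q), IsPullback s t q q)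

/-- A category is *amalgamable* if every span of monomorphisms admits a pushout which is
stable under pullback and is itself a pullback square. -/
def Amalgamable (C : Type u) [Category.{v} C] : Prop :=
  ∀ ⦃Z A B : C⦄ (f : Z ⟶ A) (g : Z ⟶ B), Mono f → Mono g →
    ∃ (D : C) (h : A ⟶ D) (k : B ⟶ D),
      IsPushout f g h k ∧ PushoutStable f g h k ∧ IsPullback f g h k

/-- A category is *adhesive* if it admits pushouts along monomorphisms, and these pushouts
are stable under pullback and are pullback squares. -/
def AdhesiveCat (C : Type u) [Category.{v} C] : Prop :=
  ∀ ⦃Z A B : C⦄ (f : Z ⟶ A) (g : Z ⟶ B), Mono f →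
    (∃ (D : C) (h : A ⟶ D) (k : B ⟶ D), IsPushout f g h k) ∧
    ∀ ⦃D : C⦄ (h : A ⟶ D) (k : B ⟶ D), IsPushout f g h k →
      PushoutStable f g h k ∧ IsPullback f g h k

/-- `u` factors through `v` (as morphisms into a common object `X`). -/
def FactorsThru {U V X : C} (u : U ⟶ X) (v : V ⟶ X) : Prop :=
  ∃ w : U ⟶ V, w ≫ v = u

/-- A monomorphism `m : P ⟶ X` is the *union* of the subobjects `a : A ⟶ X` and `b : B ⟶ X`:
both factor through `m`, and `m` factors through any monomorphism through which both factor. -/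
def IsUnionOf {A B P X : C} (a : A ⟶ X) (b : B ⟶ X) (m : P ⟶ X) : Prop :=
  Mono m ∧ FactorsThru a m ∧ FactorsThru b m ∧
  ∀ ⦃Q : C⦄ (c : Q ⟶ X), Mono c → FactorsThru a c → FactorsThru b c → FactorsThru m c

end Defs

section Covers

variable {C : Type u} [Category.{v} C]

attribute [local simp] prod.lift_fst prod.lift_snd prod.lift_fst_assoc prod.lift_snd_assoc
  pullback.lift_fst pullback.lift_snd pullback.lift_fst_assoc pullback.lift_snd_assoc

/-- A predicate `R` on generalized elements of `T` *covers* `T` if a morphism out of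
`T` factors through a monomorphism as soon as all its restrictions along the generalized elements satisfying `R` do. -/
def CoversObj (T : C) (R : ∀ ⦃S : C⦄, (S ⟶ T) → Prop) : Prop :=
  ∀ ⦃M N : C⦄ (n : M ⟶ N) (w : T ⟶ N), Mono n →
    (∀ ⦃S : C⦄ (z : S ⟶ T), R z → FactorsThru (z ≫ w) n) → FactorsThru w n

lemma CoversObj.eq_of_forall_comp_eq [HasEqualizers C] {T Y : C}
    {R : ∀ ⦃S : C⦄, (S ⟶ T) → Prop} (hR : CoversObj T R) (u v : T ⟶ Y)
    (h : ∀ ⦃S : C⦄ (z : S ⟶ T), R z → z ≫ u = z ≫ v) : u = v := by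
  obtain ⟨w, hw⟩ := hR (equalizer.ι u v) (𝟙 T) inferInstance fun S z hz =>
    ⟨equalizer.lift z (h z hz), by simp⟩
  rw [← Category.id_comp u, ← Category.id_comp v, ← hw, Category.assoc, Category.assoc,
    equalizer.condition]

lemma JointlyMonic.exists_lift [HasFiniteLimits C] {E A B T : C} {s : E ⟶ A} {t : E ⟶ B}
    (hE : JointlyMonic s t) {R : ∀ ⦃S : C⦄, (S ⟶ T) → Prop} (hR : CoversObj T R)
    {x : T ⟶ A} {y : T ⟶ B}
    (H : ∀ ⦃S : C⦄ (z : S ⟶ T), R z → ∃ e : S ⟶ E, e ≫ s = z ≫ x ∧ e ≫ t = z ≫ y) :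
    ∃ e : T ⟶ E, e ≫ s = x ∧ e ≫ t = y := by
  have hmono : Mono (prod.lift s t) := ⟨fun u v huv => hE u v
    (by simpa using congr($huv ≫ prod.fst)) (by simpa using congr($huv ≫ prod.snd))⟩
  obtain ⟨e, he⟩ := hR (prod.lift s t) (prod.lift x y) hmono fun S z hz => by
    obtain ⟨e, he₁, he₂⟩ := H z hz
    exact ⟨e, by ext <;> simpa⟩
  exact ⟨e, by simpa using congr($he ≫ prod.fst), by simpa using congr($he ≫ prod.snd)⟩

lemma coversObj_of_isRegularEpi [Regular C] {X Y T : C} (e : X ⟶ Y) [IsRegularEpi e]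
    (y : T ⟶ Y) : CoversObj T fun _ z => FactorsThru (z ≫ y) e := by
  intro M N n w _ H
  obtain ⟨l, hl⟩ := H (pullback.snd e y) ⟨pullback.fst e y, pullback.condition⟩
  have sq : CommSq l (pullback.snd e y) n w := ⟨hl⟩
  exact ⟨sq.lift, sq.fac_right⟩

lemma coversObj_of_isPushout [HasFiniteLimits C] {J A B P T : C} {p : J ⟶ A} {q : J ⟶ B}
    {i : A ⟶ P} {j : B ⟶ P} (w₀ : p ≫ i = q ≫ j) (hst : PushoutStable p q i j) (e : T ⟶ P) :
    CoversObj T fun _ z => FactorsThru (z ≫ e) i ∨ FactorsThru (z ≫ e) j := by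
  intro M N n w _ H
  have hi := IsPullback.of_hasPullback e i
  have hj := IsPullback.of_hasPullback e j
  have hp := IsPullback.of_hasPullback (pullback.snd e i) p
  have hq : IsPullback
      (hj.lift (pullback.fst (pullback.snd e i) p ≫ pullback.fst e i)
        (pullback.snd (pullback.snd e i) p ≫ q)
        (by rw [Category.assoc, hi.w, reassoc_of% hp.w, w₀, Category.assoc]))
      (pullback.snd (pullback.snd e i) p) (pullback.snd e j) q := by
    refine IsPullback.of_right (h₁₂ := pullback.fst e j) (v₁₃ := e) (h₂₂ := j) ?_ (by simp) hj
    have := hp.paste_horiz hi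
    simpa [w₀] using this
  have hpo := hst _ _ _ _ _ _ _ e hp hq hi hj (by simp)
  obtain ⟨a, ha⟩ := H (pullback.fst e i) (.inl ⟨pullback.snd e i, hi.w.symm⟩)
  obtain ⟨b, hb⟩ := H (pullback.fst e j) (.inr ⟨pullback.snd e j, hj.w.symm⟩)
  refine ⟨hpo.desc a b ?_, ?_⟩
  · rw [← cancel_mono n]
    simp [ha, hb]
  · apply hpo.hom_ext <;> simp [ha, hb]

/-- In an amalgamable category, the pushout of two subobjects over their intersection is a
subobject covered by the two. -/
lemma Amalgamable.exists_union [HasFiniteLimits C] (hAm : Amalgamable C) {A B X : C}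
    (a : A ⟶ X) (b : B ⟶ X) [Mono a] [Mono b] :
    ∃ (P : C) (m : P ⟶ X), Mono m ∧ FactorsThru a m ∧ FactorsThru b m ∧
      ∀ ⦃T : C⦄ (x : T ⟶ X), FactorsThru x m →
        CoversObj T fun _ z => FactorsThru (z ≫ x) a ∨ FactorsThru (z ≫ x) b := by
  obtain ⟨P, i, j, hpo, hst, -⟩ := hAm (pullback.fst a b) (pullback.snd a b)
    inferInstance inferInstance
  let m : P ⟶ X := hpo.desc a b pullback.condition
  have him : i ≫ m = a := hpo.inl_desc ..
  have hjm : j ≫ m = b := hpo.inr_desc ..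
  have mixed : ∀ {S : C} (s : S ⟶ A) (t : S ⟶ B), s ≫ a = t ≫ b → s ≫ i = t ≫ j := by
    intro S s t h
    simpa using congr(pullback.lift s t h ≫ $hpo.w)
  refine ⟨P, m, ⟨fun {T} u v huv => ?_⟩, ⟨i, him⟩, ⟨j, hjm⟩, ?_⟩
  · refine (coversObj_of_isPushout hpo.w hst u).eq_of_forall_comp_eq u v fun S z hz => ?_
    refine (coversObj_of_isPushout hpo.w hst (z ≫ v)).eq_of_forall_comp_eq _ _ fun S' z' hz' => ?_
    have key : z' ≫ (z ≫ u) ≫ m = (z' ≫ z ≫ v) ≫ m := by simp [huv]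
    rcases hz with ⟨s, hs⟩ | ⟨s, hs⟩ <;> rcases hz' with ⟨t, ht⟩ | ⟨t, ht⟩ <;>
      rw [← hs, ← ht] at key ⊢ <;> simp only [Category.assoc, him, hjm] at key
    · have := (cancel_mono a).1 ((Category.assoc _ _ _).trans key)
      rw [← Category.assoc, this]
    · rw [← Category.assoc]
      exact mixed _ _ ((Category.assoc _ _ _).trans key)
    · rw [← Category.assoc]
      exact (mixed _ _ (key.symm.trans (Category.assoc _ _ _).symm)).symm
    · have := (cancel_mono b).1 ((Category.assoc _ _ _).trans key)
      rw [← Category.assoc, this]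
  · rintro T x ⟨e, rfl⟩ M N n w hn H
    refine coversObj_of_isPushout hpo.w hst e n w hn fun S z hz => H z ?_
    rcases hz with ⟨s, hs⟩ | ⟨s, hs⟩
    · exact .inl ⟨s, by rw [← him, reassoc_of% hs]⟩
    · exact .inr ⟨s, by rw [← hjm, reassoc_of% hs]⟩

lemma exists_image_covers [Regular C] {K X : C} (r : K ⟶ X) :
    ∃ (I : C) (m : I ⟶ X), Mono m ∧ FactorsThru r m ∧
      ∀ ⦃T : C⦄ (x : T ⟶ X), FactorsThru x m → CoversObj T fun _ z => FactorsThru (z ≫ x) r := by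
  let F := Regular.strongEpiMonoFactorisation r
  refine ⟨F.I, F.m, inferInstance, ⟨F.e, F.fac⟩, ?_⟩
  rintro T x ⟨y, rfl⟩ M N n w hn H
  refine coversObj_of_isRegularEpi F.e y n w hn fun S z hz => H z ?_
  obtain ⟨s, hs⟩ := hz
  exact ⟨s, by rw [← Category.assoc, ← hs, Category.assoc, F.fac]⟩

/-- The generalized elements of `T` at which `x` and `y` agree, or are the images under `f` of
two elements with the same image under `g`. -/
def RelatedAt {Z A B T : C} (f : Z ⟶ A) (g : Z ⟶ B) (x y : T ⟶ A) ⦃S : C⦄ (z : S ⟶ T) : Prop :=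
  z ≫ x = z ≫ y ∨ ∃ c d : S ⟶ Z, c ≫ g = d ≫ g ∧ c ≫ f = z ≫ x ∧ d ≫ f = z ≫ y

/-- The reflexive closure of the image under `f` of the kernel pair of `g`. -/
lemma exists_reflexive_relation [Regular C] (hAm : Amalgamable C) {Z A B : C}
    (f : Z ⟶ A) (g : Z ⟶ B) :
    ∃ (E : C) (s t : E ⟶ A), JointlyMonic s t ∧ (∃ r : A ⟶ E, r ≫ s = 𝟙 A ∧ r ≫ t = 𝟙 A) ∧
      (∀ ⦃S : C⦄ (c d : S ⟶ Z), c ≫ g = d ≫ g → ∃ e : S ⟶ E, e ≫ s = c ≫ f ∧ e ≫ t = d ≫ f) ∧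
      ∀ ⦃T : C⦄ (e : T ⟶ E), CoversObj T (RelatedAt f g (e ≫ s) (e ≫ t)) := by
  obtain ⟨I, μ, hμ, ⟨ρ, hρ⟩, hI⟩ := exists_image_covers
    (prod.lift (pullback.fst g g ≫ f) (pullback.snd g g ≫ f))
  obtain ⟨E, m, hm, ⟨r, hr⟩, ⟨l, hl⟩, hE⟩ := hAm.exists_union (prod.lift (𝟙 A) (𝟙 A)) μ
  refine ⟨E, m ≫ prod.fst, m ≫ prod.snd, fun X u v h₁ h₂ => ?_, ⟨r, ?_, ?_⟩, ?_, ?_⟩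
  · rw [← cancel_mono m]
    ext <;> simpa
  · simp [reassoc_of% hr]
  · simp [reassoc_of% hr]
  · intro S c d h
    refine ⟨pullback.lift c d h ≫ ρ ≫ l, ?_, ?_⟩ <;> simp [reassoc_of% hl, reassoc_of% hρ]
  · intro T e M N n w hn H
    refine hE (e ≫ m) ⟨e, rfl⟩ n w hn fun S z hz => ?_
    rcases hz with ⟨a, ha⟩ | hz
    · refine H z (.inl ?_)
      have h₁ := congr($ha ≫ prod.fst)
      have h₂ := congr($ha ≫ prod.snd)
      simp only [Category.assoc, prod.lift_fst, prod.lift_snd, Category.comp_id] at h₁ h₂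
      exact h₁.symm.trans h₂
    · refine hI (z ≫ e ≫ m) hz n (z ≫ w) hn fun S' z' hz' => ?_
      obtain ⟨k, hk⟩ := hz'
      have h₁ := congr($hk ≫ prod.fst)
      have h₂ := congr($hk ≫ prod.snd)
      simp only [Category.assoc, prod.lift_fst, prod.lift_snd] at h₁ h₂
      simpa using H (z' ≫ z) (.inr ⟨k ≫ pullback.fst g g, k ≫ pullback.snd g g,
        by simp [pullback.condition], by simpa using h₁, by simpa using h₂⟩)

lemma IsMalcevSpan.exists_mul [HasFiniteLimits C] {Z A B S : C} {f : Z ⟶ A} {g : Z ⟶ B}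
    (hM : IsMalcevSpan f g) (c₁ c₂ c₃ : S ⟶ Z) (h₁ : c₁ ≫ g = c₂ ≫ g) (h₂ : c₂ ≫ f = c₃ ≫ f) :
    ∃ p : S ⟶ Z, p ≫ f = c₁ ≫ f ∧ p ≫ g = c₃ ≫ g := by
  obtain ⟨p, hp₁, hp₂⟩ := hM.2
    (pullback.fst (pullback.snd g g) (pullback.fst f f) ≫ pullback.fst g g)
    (pullback.fst (pullback.snd g g) (pullback.fst f f) ≫ pullback.snd g g)
    (pullback.snd (pullback.snd g g) (pullback.fst f f) ≫ pullback.snd f f)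
    { w₁ := by rw [Category.assoc, Category.assoc, pullback.condition]
      w₂ := by rw [pullback.condition (f := pullback.snd g g), Category.assoc,
        Category.assoc, pullback.condition]
      lift := by
        intro X x₁ x₂ x₃ h h'
        refine ⟨pullback.lift (pullback.lift x₁ x₂ h) (pullback.lift x₂ x₃ h') (by simp),
          by simp, ?_⟩
        rintro u ⟨rfl, rfl, rfl⟩
        ext <;> simp [pullback.condition] }
  refine ⟨pullback.lift (pullback.lift c₁ c₂ h₁) (pullback.lift c₂ c₃ h₂) (by simp) ≫ p, ?_, ?_⟩
  · simp [hp₁]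
  · simp [hp₂]

lemma IsMalcevSpan.isEquivRelation [HasFiniteLimits C] {Z A B E : C} {f : Z ⟶ A} {g : Z ⟶ B}
    (hM : IsMalcevSpan f g) {s t : E ⟶ A} (hE : JointlyMonic s t)
    (hrefl : ∃ r : A ⟶ E, r ≫ s = 𝟙 A ∧ r ≫ t = 𝟙 A)
    (hK : ∀ ⦃S : C⦄ (c d : S ⟶ Z), c ≫ g = d ≫ g → ∃ e : S ⟶ E, e ≫ s = c ≫ f ∧ e ≫ t = d ≫ f)
    (hcov : ∀ ⦃T : C⦄ (e : T ⟶ E), CoversObj T (RelatedAt f g (e ≫ s) (e ≫ t))) :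
    IsEquivRelation s t := by
  refine ⟨hE, hrefl, hE.exists_lift (hcov (𝟙 E)) fun S z hz => ?_,
    hE.exists_lift (hcov (pullback.fst t s)) fun S z hz => ?_⟩
  · rw [RelatedAt, Category.id_comp, Category.id_comp] at hz
    rcases hz with hz | ⟨c, d, hcd, hc, hd⟩
    · exact ⟨z, hz, hz.symm⟩
    · rw [← hc, ← hd]
      exact hK d c hcd.symm
  · rcases hz with hz | ⟨c, d, hcd, hc, hd⟩
    · refine ⟨z ≫ pullback.snd t s, ?_, by simp⟩
      rw [hz, pullback.condition, Category.assoc]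
    · refine hE.exists_lift (hcov (z ≫ pullback.snd t s)) fun S' z' hz' => ?_
      rcases hz' with hz' | ⟨c', d', hcd', hc', hd'⟩
      · refine ⟨z' ≫ z ≫ pullback.fst t s, by simp, ?_⟩
        simpa [pullback.condition] using hz'
      · obtain ⟨p, hp₁, hp₂⟩ := hM.exists_mul (z' ≫ c) (z' ≫ d) c' (by simp [hcd])
          (by simp [hc', hd, pullback.condition])
        obtain ⟨e, he₁, he₂⟩ := hK p d' (hp₂.trans hcd')
        exact ⟨e, by simp [he₁, hp₁, hc], by simp [he₂, hd']⟩

/-- If the kernel pair of `h` is covered by the diagonal and the image of the kernel pair of `g`,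
then the square is a pushout, stably under pullback. -/
lemma pushoutStable_of_covers [Regular C] {Z A B D : C} {f : Z ⟶ A} {g : Z ⟶ B} {h : A ⟶ D}
    {k : B ⟶ D} [IsRegularEpi g] [IsRegularEpi h]
    (hcov : ∀ ⦃T : C⦄ (x y : T ⟶ A), x ≫ h = y ≫ h → CoversObj T (RelatedAt f g x y)) :
    PushoutStable f g h k := by
  intro Z' A' B' D' f' g' h' k' αZ αA αB αD hf hg hh hk w'
  have : IsRegularEpi g' :=
    Regular.regularEpiIsStableUnderBaseChange.of_isPullback hg.flip ‹IsRegularEpi g›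
  have : IsRegularEpi h' :=
    Regular.regularEpiIsStableUnderBaseChange.of_isPullback hh.flip ‹IsRegularEpi h›
  have : Epi g' := (IsRegularEpi.getStruct g').epi
  have : Epi h' := (IsRegularEpi.getStruct h').epi
  refine ⟨⟨w'⟩, ⟨PushoutCocone.IsColimit.mk _
    (fun c => IsRegularEpi.desc h' c.inl ?_) (fun c => IsRegularEpi.fac ..) (fun c => ?_)
    (fun c l hl _ => ?_)⟩⟩
  · set x := IsRegularEpi.left h'
    set y := IsRegularEpi.right h'
    have hxy : x ≫ h' = y ≫ h' := IsRegularEpi.w h'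
    refine (hcov (x ≫ αA) (y ≫ αA) ?_).eq_of_forall_comp_eq _ _ fun S z hz => ?_
    · simp only [Category.assoc, ← hh.w, reassoc_of% hxy]
    · rcases hz with hz | ⟨a, b, hab, ha, hb⟩
      · have : z ≫ x = z ≫ y := hh.hom_ext (by simp [hxy]) (by simpa using hz)
        rw [reassoc_of% this]
      · rw [← Category.assoc] at ha hb
        have e₁ := hf.lift_fst _ _ ha.symm
        have e₂ := hf.lift_fst _ _ hb.symm
        have e : hf.lift _ _ ha.symm ≫ g' = hf.lift _ _ hb.symm ≫ g' := by
          apply hk.hom_ext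
          · simp [← w', reassoc_of% e₁, reassoc_of% e₂, hxy]
          · simp [hg.w, hab]
        rw [← reassoc_of% e₁, ← reassoc_of% e₂, c.condition, reassoc_of% e]
  · rw [← cancel_epi g', ← reassoc_of% w', IsRegularEpi.fac, c.condition]
  · rw [← cancel_epi h', hl, IsRegularEpi.fac]

lemma BarrExact.regular [HasFiniteLimits C] (hBE : BarrExact C) : Regular C where
  hasCoequalizer_of_isKernelPair {X Y W f g₁ g₂} hk := by
    have := hBE.1 f
    refine ⟨⟨⟨Cofork.ofπ (coequalizer.π (pullback.fst f f) (pullback.snd f f)) ?_, ?_⟩⟩⟩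
    · simpa using congr(hk.isoPullback.hom ≫
        $(coequalizer.condition (pullback.fst f f) (pullback.snd f f)))
    · refine Cofork.IsColimit.mk _
        (fun c => coequalizer.desc (f := pullback.fst f f) (g := pullback.snd f f) c.π ?_)
        (fun c => coequalizer.π_desc ..) (fun c l hl => ?_)
      · simpa using congr(hk.isoPullback.inv ≫ $c.condition)
      · exact coequalizer.hom_ext (f := pullback.fst f f) (g := pullback.snd f f)
          (hl.trans (coequalizer.π_desc ..).symm)
  regularEpiIsStableUnderBaseChange := .mk' fun _ _ _ f g _ hg =>
    ⟨(hBE.2.1 g f hg.regularEpi).map fun h =>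
      h.ofArrowIso (Arrow.isoMk (pullbackSymmetry g f) (Iso.refl _) (by simp))⟩

/-- In a Barr-exact category, an equivalence relation is the kernel pair of a regular
epimorphism. -/
lemma BarrExact.exists_isRegularEpi_isPullback [HasFiniteLimits C] (hBE : BarrExact C)
    {E A : C} {s t : E ⟶ A} (h : IsEquivRelation s t) :
    ∃ (D : C) (q : A ⟶ D), IsRegularEpi q ∧ IsPullback s t q q := by
  have := hBE.regular
  obtain ⟨Q, q, hq⟩ := hBE.2.2 s t h
  have := Regular.hasCoequalizer_of_isKernelPair hq
  refine ⟨_, coequalizer.π s t, inferInstance, ⟨⟨coequalizer.condition s t⟩,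
    ⟨PullbackCone.IsLimit.mk _ (fun c => hq.lift c.fst c.snd ?_) (fun c => hq.lift_fst ..)
      (fun c => hq.lift_snd ..) (fun c l h₁ h₂ => hq.hom_ext (by simpa using h₁)
        (by simpa using h₂))⟩⟩⟩
  rw [← coequalizer.π_desc q hq.w, reassoc_of% c.condition]

end Covers

/-- In a finitely complete, Barr-exact and amalgamable category, every
Mal'cev span `(f, g)` with `g` a regular epimorphism admits a pushout which is stable
under pullback and is itself a pullback square. -/
theorem malcev_span_regularEpi_pushout {C : Type u} [Category.{v} C] [HasFiniteLimits C]
    (hBE : BarrExact C) (hAm : Amalgamable C)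
    {Z A B : C} (f : Z ⟶ A) (g : Z ⟶ B) (hM : IsMalcevSpan f g)
    (hg : Nonempty (RegularEpi g)) :
    ∃ (D : C) (h : A ⟶ D) (k : B ⟶ D),
      IsPushout f g h k ∧ PushoutStable f g h k ∧ IsPullback f g h k := by
  have := hBE.regular
  have : IsRegularEpi g := ⟨hg⟩
  obtain ⟨E, s, t, hE, hrefl, hK, hcov⟩ := exists_reflexive_relation hAm f g
  obtain ⟨D, h, hh, hpb⟩ := hBE.exists_isRegularEpi_isPullback
    (hM.isEquivRelation hE hrefl hK hcov)
  have hfh : IsRegularEpi.left g ≫ f ≫ h = IsRegularEpi.right g ≫ f ≫ h := by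
    obtain ⟨e, he₁, he₂⟩ := hK _ _ (IsRegularEpi.w g)
    rw [← reassoc_of% he₁, ← reassoc_of% he₂, hpb.w]
  let k : B ⟶ D := IsRegularEpi.desc g (f ≫ h) hfh
  have w : f ≫ h = g ≫ k := (IsRegularEpi.fac g _ hfh).symm
  have hcov' : ∀ ⦃T : C⦄ (x y : T ⟶ A), x ≫ h = y ≫ h → CoversObj T (RelatedAt f g x y) := by
    intro T x y hxy
    have := hcov (hpb.lift x y hxy)
    rwa [hpb.lift_fst, hpb.lift_snd] at this
  have hst := pushoutStable_of_covers (k := k) hcov'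
  refine ⟨D, h, k, hst f g h k (𝟙 Z) (𝟙 A) (𝟙 B) (𝟙 D) (.of_id_snd) (.of_id_snd)
    (.of_id_snd) (.of_id_snd) w, hst, ⟨w⟩, ⟨PullbackCone.isLimitAux' _ fun c => ?_⟩⟩
  suffices ∃ l : c.pt ⟶ Z, l ≫ f = c.fst ∧ l ≫ g = c.snd from
    ⟨this.choose, this.choose_spec.1, this.choose_spec.2, fun {m} h₁ h₂ =>
      hM.1 _ _ (h₁.trans this.choose_spec.1.symm) (h₂.trans this.choose_spec.2.symm)⟩
  refine hM.1.exists_lift (coversObj_of_isRegularEpi g c.snd) fun S z ⟨a, ha⟩ => ?_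
  have hza : (z ≫ c.fst) ≫ h = (a ≫ f) ≫ h := by
    rw [Category.assoc, c.condition, ← reassoc_of% ha, ← w, Category.assoc]
  refine hM.1.exists_lift (hcov' _ _ hza) fun S' z' hz' => ?_
  rcases hz' with hz' | ⟨b, d, hbd, hb, hd⟩
  · exact ⟨z' ≫ a, by simpa using hz'.symm, by simp [ha]⟩
  · obtain ⟨p, hp₁, hp₂⟩ := hM.exists_mul b d (z' ≫ a) hbd (by simpa using hd)
    exact ⟨p, hp₁.trans hb, by simp [hp₂, ha]⟩
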